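/- arXiv:math/0107064 — 2 statements merged into one kernel-verified Lean document; each statement's English description precedes it below -/
import Mathlib

section
/- (Endomorphism ring theorem, concrete form.) Let k be a field, N ⊆ M unital k-algebras, E : M → N an N-bimodule map with E(1) = 1 and dual bases x₁,…,xₙ, y₁,…,yₙ ∈ M (∑ᵢ E(m xᵢ)yᵢ = m = ∑ᵢ xᵢ E(yᵢ m) for all m), with C_M(N) = k·1 and ∑ᵢ xᵢyᵢ = λ⁻¹·1 for a nonzero λ ∈ k. Let 𝓔 := End(M_N), ℓ : M → 𝓔 the left-regular representation, and define Φ : 𝓔 → M by Φ(f) := λ ∑ᵢ f(xᵢ)yᵢ. Set uᵢ := λ⁻¹ ℓ_{xᵢ} ∘ E and vᵢ := E ∘ ℓ_{yᵢ} in 𝓔 (E is right N-linear, hence E ∈ 𝓔). Then: (a) Φ(ℓ_m ∘ f ∘ ℓ_{m'}) = m Φ(f) m' for all m, m' ∈ M, f ∈ 𝓔; (b) Φ(id) = 1; (c) for every f ∈ 𝓔, ∑ᵢ ℓ_{Φ(f ∘ uᵢ)} ∘ vᵢ = f = ∑ᵢ uᵢ ∘ ℓ_{Φ(vᵢ ∘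 f)}; (d) ∑ᵢ uᵢ ∘ vᵢ = λ⁻¹·id; (e) the centralizer of ℓ(M) in 𝓔 is k·id. (That is, 𝓔/ℓ(M) is again a strongly separable, irreducible extension of index λ⁻¹, with conditional expectation ℓ ∘ Φ and dual bases {uᵢ}, {vᵢ}.) -/
/-- **Endomorphism ring theorem, concrete form.** Let `E : M → N` be a conditional
expectation (`E(1) = 1`) with dual bases `{xᵢ}, {yᵢ}`, trivial centralizer
`C_M(N) = k·1` and index `∑ᵢ xᵢyᵢ = λ⁻¹·1 ≠ 0`. With `Φ(f) := λ ∑ᵢ f(xᵢ)yᵢ`,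
`uᵢ := λ⁻¹ ℓ_{xᵢ} ∘ E` and `vᵢ := E ∘ ℓ_{yᵢ}`, the extension `𝓔 = End(M_N)` of
`ℓ(M)` is again strongly separable and irreducible of index `λ⁻¹`: (a) `Φ` is an
`M`-bimodule map, (b) `Φ(id) = 1`, (c) `{uᵢ}, {vᵢ}` are dual bases for the
conditional expectation `ℓ ∘ Φ` on the right-`N`-linear endomorphisms, (d)
`∑ᵢ uᵢ ∘ vᵢ = λ⁻¹·id`, (e) the centralizer of `ℓ(M)` in `𝓔` is trivial. -/
theorem endomorphism_ring_theorem
    (k : Type*) [Field k] (M : Type*) [Ring M] [Algebra k M]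
    (N : Subalgebra k M)
    (E : M →ₗ[k] M)
    (hE_mem : ∀ m : M, E m ∈ N)
    (hE_bimod : ∀ n ∈ N, ∀ n' ∈ N, ∀ m : M, E (n * m * n') = n * E m * n')
    (hE_one : E 1 = 1)
    (n : ℕ) (x y : Fin n → M)
    (hE₁ : ∀ m : M, ∑ i, E (m * x i) * y i = m)
    (hE₂ : ∀ m : M, ∑ i, x i * E (y i * m) = m)
    (hcent : ∀ c : M, (∀ n' ∈ N, c * n' = n' * c) → ∃ μ : k, c = μ • (1 : M))
    (lam : k) (hlam : lam ≠ 0)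
    (hindex : ∑ i, x i * y i = lam⁻¹ • (1 : M))
    (Φ : (M →ₗ[k] M) → M) (hΦ : ∀ f, Φ f = lam • ∑ i, f (x i) * y i)
    (u v : Fin n → (M →ₗ[k] M))
    (hu : ∀ i, u i = lam⁻¹ • (LinearMap.mulLeft k (x i) ∘ₗ E))
    (hv : ∀ i, v i = E ∘ₗ LinearMap.mulLeft k (y i)) :
    (∀ m m' : M, ∀ f : M →ₗ[k] M, (∀ a : M, ∀ n' ∈ N, f (a * n') = f a * n') →
      Φ (LinearMap.mulLeft k m ∘ₗ f ∘ₗ LinearMap.mulLeft k m') = m * Φ f * m') ∧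
    Φ LinearMap.id = 1 ∧
    (∀ f : M →ₗ[k] M, (∀ a : M, ∀ n' ∈ N, f (a * n') = f a * n') →
      ∑ i, LinearMap.mulLeft k (Φ (f ∘ₗ u i)) ∘ₗ v i = f ∧
      ∑ i, u i ∘ₗ LinearMap.mulLeft k (Φ (v i ∘ₗ f)) = f) ∧
    (∑ i, u i ∘ₗ v i = lam⁻¹ • LinearMap.id) ∧
    (∀ f : M →ₗ[k] M, (∀ a : M, ∀ n' ∈ N, f (a * n') = f a * n') →
      (∀ m a : M, f (m * a) = m * f a) → ∃ μ : k, f = μ • LinearMap.id) := by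
  have hEr : ∀ m : M, ∀ n' ∈ N, E (m * n') = E m * n' := fun m n' hn' => by
    simpa using hE_bimod 1 N.one_mem n' hn' m
  have hEl : ∀ m : M, ∀ n' ∈ N, E (n' * m) = n' * E m := fun m n' hn' => by
    simpa using hE_bimod n' hn' 1 N.one_mem m
  have hEE : ∀ m : M, E (E m) = E m := fun m => by
    simpa [hE_one] using hEl 1 (E m) (hE_mem m)
  have hexpand : ∀ f : M →ₗ[k] M, (∀ a : M, ∀ n' ∈ N, f (a * n') = f a * n') →
      ∀ m : M, ∑ i, f (x i) * E (y i * m) = f m := fun f hf m => by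
    conv_rhs => rw [← hE₂ m, map_sum]
    exact Finset.sum_congr rfl fun i _ => (hf _ _ (hE_mem _)).symm
  refine ⟨fun m m' f hf => ?_, ?_, fun f hf => ⟨?_, ?_⟩, ?_, fun f hf hfl => ?_⟩
  · have hbalanced : ∑ i, f (m' * x i) * y i = (∑ i, f (x i) * y i) * m' := by
      calc ∑ i, f (m' * x i) * y i
          = ∑ i, ∑ j, f (x j) * (E (y j * m' * x i) * y i) := by
            refine Finset.sum_congr rfl fun i _ => ?_
            rw [← hexpand f hf (m' * x i), Finset.sum_mul]
            simp only [mul_assoc]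
        _ = ∑ j, f (x j) * (y j * m') := by
            rw [Finset.sum_comm]
            simp only [← Finset.mul_sum, hE₁]
        _ = (∑ i, f (x i) * y i) * m' := by
            simp only [Finset.sum_mul, mul_assoc]
    simp only [hΦ, LinearMap.comp_apply, LinearMap.mulLeft_apply, mul_assoc m,
      ← Finset.mul_sum, hbalanced, mul_smul_comm, smul_mul_assoc]
  · simp [hΦ, hindex, smul_smul, hlam]
  · have hcoeff : ∀ i, Φ (f ∘ₗ u i) = f (x i) := fun i => by
      have hone := hE₁ 1
      simp only [one_mul] at hone
      simp only [hΦ, hu, LinearMap.comp_apply, LinearMap.smul_apply, LinearMap.mulLeft_apply,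
        map_smul, hf _ _ (hE_mem _), smul_mul_assoc, ← Finset.smul_sum, mul_assoc,
        ← Finset.mul_sum, hone, mul_one, smul_smul, mul_inv_cancel₀ hlam, one_smul]
    ext a
    simpa [hcoeff, hv] using hexpand f hf a
  · have hcoeff : ∀ i a, E (Φ (v i ∘ₗ f) * a) = lam • E (y i * f a) := fun i a => by
      rw [← hexpand f hf a]
      simp only [hΦ, hv, LinearMap.comp_apply, LinearMap.mulLeft_apply, smul_mul_assoc, map_smul,
        Finset.sum_mul, Finset.mul_sum, map_sum, mul_assoc, hEl _ _ (hE_mem _)]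
      congr 1
      refine Finset.sum_congr rfl fun j _ => ?_
      rw [← mul_assoc, hEr _ _ (hE_mem _)]
    ext a
    simp only [LinearMap.sum_apply, hu, LinearMap.comp_apply, LinearMap.smul_apply,
      LinearMap.mulLeft_apply, hcoeff, mul_smul_comm, smul_smul, inv_mul_cancel₀ hlam, one_smul,
      hE₂]
  · ext a
    simp only [LinearMap.sum_apply, hu, hv, LinearMap.comp_apply, LinearMap.smul_apply,
      LinearMap.mulLeft_apply, hEE, ← Finset.smul_sum, hE₂, LinearMap.id_apply]
  · have hf_one : ∀ m, f m = m * f 1 := fun m => by simpa using hfl m 1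
    obtain ⟨μ, hμ⟩ := hcent (f 1) fun n' hn' => by
      rw [← hf 1 n' hn', one_mul, hf_one]
    refine ⟨μ, LinearMap.ext fun m => ?_⟩
    simp [hf_one m, hμ]
end

section
/- In the depth-2 Jones tower setup: (a) there exists a unique map S : B → B such that E_{M₁}(b e₁ e₂) = E_{M₁}(e₂ e₁ S(b)) for all b ∈ B, and S is bijective; (b) S² is the inverse of the Nakayama automorphism of the Frobenius functional E_{M₁}|_B, i.e., E_{M₁}(b b') = E_{M₁}(b' S(S(b))) for all b, b' ∈ B; (c) moreover E_{M₁}(b x e₂) = E_{M₁}(e₂ x S(b)) for all b ∈ B and x ∈ M₁. -/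
open scoped TensorProduct

/-- The depth-2 Jones tower setup: a tower `N ⊆ M ⊆ M₁ ⊆ R` (with `R` playing the
role of `M₂`) of unital `k`-algebras, with conditional expectations, Jones idempotents,
braid-like relations and depth-2 orthogonal dual bases, as in the paper. -/
structure JonesTower (k : Type*) [Field k] (R : Type*) [Ring R] [Algebra k R] where
  N : Subalgebra k R
  M : Subalgebra k R
  M₁ : Subalgebra k R
  hNM : N ≤ M
  hMM₁ : M ≤ M₁
  lam : k
  hlam : lam ≠ 0
  E : R →ₗ[k] R
  EM : R →ₗ[k] R
  EM1 : R →ₗ[k] R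
  hE_mem : ∀ m ∈ M, E m ∈ N
  hEM_mem : ∀ x ∈ M₁, EM x ∈ M
  hEM1_mem : ∀ x : R, EM1 x ∈ M₁
  hE_one : E 1 = 1
  hEM_one : EM 1 = 1
  hEM1_one : EM1 1 = 1
  hE_bimod : ∀ n ∈ N, ∀ n' ∈ N, ∀ m ∈ M, E (n * m * n') = n * E m * n'
  hEM_bimod : ∀ m ∈ M, ∀ m' ∈ M, ∀ x ∈ M₁, EM (m * x * m') = m * EM x * m'
  hEM1_bimod : ∀ w ∈ M₁, ∀ w' ∈ M₁, ∀ x : R, EM1 (w * x * w') = w * EM1 x * w'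
  n₀ : ℕ
  xb : Fin n₀ → R
  yb : Fin n₀ → R
  hxb : ∀ i, xb i ∈ M
  hyb : ∀ i, yb i ∈ M
  hE_dual₁ : ∀ m ∈ M, ∑ i, E (m * xb i) * yb i = m
  hE_dual₂ : ∀ m ∈ M, ∑ i, xb i * E (yb i * m) = m
  hE_index : ∑ i, xb i * yb i = lam⁻¹ • (1 : R)
  hCMN : ∀ c ∈ M, (∀ n ∈ N, c * n = n * c) → ∃ μ : k, c = μ • (1 : R)
  hCM₁M : ∀ c ∈ M₁, (∀ m ∈ M, c * m = m * c) → ∃ μ : k, c = μ • (1 : R)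
  hCM₂M₁ : ∀ c : R, (∀ w ∈ M₁, c * w = w * c) → ∃ μ : k, c = μ • (1 : R)
  e₁ : R
  e₂ : R
  he₁ : e₁ ∈ M₁
  he₁N : ∀ n ∈ N, e₁ * n = n * e₁
  he₂M : ∀ m ∈ M, e₂ * m = m * e₂
  he₁me₁ : ∀ m ∈ M, e₁ * m * e₁ = E m * e₁
  he₂we₂ : ∀ w ∈ M₁, e₂ * w * e₂ = EM w * e₂
  hEMe₁ : EM e₁ = lam • (1 : R)
  hEM1e₂ : EM1 e₂ = lam • (1 : R)
  hspanM₁ : Subalgebra.toSubmodule M₁ =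
    Submodule.span k {x : R | ∃ m ∈ M, ∃ m' ∈ M, x = m * e₁ * m'}
  hspanM₂ : (⊤ : Submodule k R) =
    Submodule.span k {x : R | ∃ w ∈ M₁, ∃ w' ∈ M₁, x = w * e₂ * w'}
  hbraid₁ : e₁ * e₂ * e₁ = lam • e₁
  hbraid₂ : e₂ * e₁ * e₂ = lam • e₂
  r : ℕ
  zb : Fin r → R
  wb : Fin r → R
  hzbM₁ : ∀ i, zb i ∈ M₁
  hwbM₁ : ∀ i, wb i ∈ M₁
  hzbN : ∀ i, ∀ n ∈ N, zb i * n = n * zb i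
  hwbN : ∀ i, ∀ n ∈ N, wb i * n = n * wb i
  hzw_orth : ∀ i j, EM (wb i * zb j) = if i = j then (1 : R) else 0
  hzw_dual₁ : ∀ x ∈ M₁, ∑ i, EM (x * zb i) * wb i = x
  hzw_dual₂ : ∀ x ∈ M₁, ∑ i, zb i * EM (wb i * x) = x
  hzw_index : ∑ i, zb i * wb i = lam⁻¹ • (1 : R)
  s : ℕ
  ub : Fin s → R
  vb : Fin s → R
  hubM : ∀ i, ∀ m ∈ M, ub i * m = m * ub i
  hvbM : ∀ i, ∀ m ∈ M, vb i * m = m * vb i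
  huv_orth : ∀ i j, EM1 (vb i * ub j) = if i = j then (1 : R) else 0
  huv_dual₁ : ∀ x : R, ∑ i, EM1 (x * ub i) * vb i = x
  huv_dual₂ : ∀ x : R, ∑ i, ub i * EM1 (vb i * x) = x
  huv_index : ∑ i, ub i * vb i = lam⁻¹ • (1 : R)
  F : R →ₗ[k] k
  hF : ∀ c : R, (∀ n ∈ N, c * n = n * c) → algebraMap k R (F c) = EM (EM1 c)

variable {k : Type*} [Field k] {R : Type*} [Ring R] [Algebra k R]

/-- The second centralizer `A = C_{M₁}(N)`. -/
def JonesTower.A (T : JonesTower k R) : Subalgebra k R :=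
  T.M₁ ⊓ Subalgebra.centralizer k (T.N : Set R)

/-- The second centralizer `B = C_{M₂}(M)`. -/
def JonesTower.B (T : JonesTower k R) : Subalgebra k R :=
  Subalgebra.centralizer k (T.M : Set R)

/-- The big centralizer `C = C_{M₂}(N)`. -/
def JonesTower.C (T : JonesTower k R) : Subalgebra k R :=
  Subalgebra.centralizer k (T.N : Set R)

namespace JonesTower

theorem mem_B {T : JonesTower k R} {b : R} : b ∈ T.B ↔ ∀ m ∈ T.M, m * b = b * m :=
  Subalgebra.mem_centralizer_iff k

theorem mem_A {T : JonesTower k R} {a : R} :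
    a ∈ T.A ↔ a ∈ T.M₁ ∧ ∀ n ∈ T.N, n * a = a * n :=
  and_congr Iff.rfl (Subalgebra.mem_centralizer_iff k)

variable (T : JonesTower k R)

theorem EM1_left {w : R} (hw : w ∈ T.M₁) (x : R) : T.EM1 (w * x) = w * T.EM1 x := by
  simpa using T.hEM1_bimod w hw 1 (one_mem _) x

theorem EM1_right {w : R} (hw : w ∈ T.M₁) (x : R) : T.EM1 (x * w) = T.EM1 x * w := by
  simpa using T.hEM1_bimod 1 (one_mem _) w hw x

theorem M₁_induction {p : R → Prop} (hgen : ∀ m ∈ T.M, ∀ m' ∈ T.M, p (m * T.e₁ * m'))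
    (hzero : p 0) (hadd : ∀ x y, p x → p y → p (x + y)) (hsmul : ∀ (c : k) x, p x → p (c • x))
    {x : R} (hx : x ∈ T.M₁) : p x := by
  have hx' : x ∈ Submodule.span k {x : R | ∃ m ∈ T.M, ∃ m' ∈ T.M, x = m * T.e₁ * m'} := by
    rw [← T.hspanM₁]; exact hx
  clear hx
  induction hx' using Submodule.span_induction with
  | mem x h => obtain ⟨m, hm, m', hm', rfl⟩ := h; exact hgen m hm m' hm'
  | zero => exact hzero
  | add x y _ _ h₁ h₂ => exact hadd x y h₁ h₂
  | smul c x _ h => exact hsmul c x h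

theorem M₂_induction {p : R → Prop} (hgen : ∀ w ∈ T.M₁, ∀ w' ∈ T.M₁, p (w * T.e₂ * w'))
    (hzero : p 0) (hadd : ∀ x y, p x → p y → p (x + y)) (hsmul : ∀ (c : k) x, p x → p (c • x))
    (x : R) : p x := by
  have hx : x ∈ Submodule.span k {x : R | ∃ w ∈ T.M₁, ∃ w' ∈ T.M₁, x = w * T.e₂ * w'} := by
    rw [← T.hspanM₂]; trivial
  induction hx using Submodule.span_induction with
  | mem x h => obtain ⟨m, hm, m', hm', rfl⟩ := h; exact hgen m hm m' hm'
  | zero => exact hzero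
  | add x y _ _ h₁ h₂ => exact hadd x y h₁ h₂
  | smul c x _ h => exact hsmul c x h

theorem e₂_mul_EM1 (x : R) : T.e₂ * T.EM1 (T.e₂ * x) = T.lam • (T.e₂ * x) := by
  refine T.M₂_induction (p := fun x ↦ T.e₂ * T.EM1 (T.e₂ * x) = T.lam • (T.e₂ * x))
    ?_ (by simp) ?_ ?_ x
  · intro w hw w' hw'
    have h : T.e₂ * (w * T.e₂ * w') = T.EM w * T.e₂ * w' := by
      rw [← T.he₂we₂ w hw]; simp only [mul_assoc]
    have hM := T.hEM_mem w hw
    rw [h, T.hEM1_bimod _ (T.hMM₁ hM) _ hw', T.hEM1e₂]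
    simp only [mul_smul_comm, smul_mul_assoc, mul_one]
    rw [← mul_assoc, T.he₂M _ hM]
  · intro x y hx hy
    simp only [mul_add, map_add, hx, hy, smul_add]
  · intro c x hx
    simp only [mul_smul_comm, map_smul, hx]
    rw [smul_comm]

theorem EM1_mul_e₂ (x : R) : T.EM1 (x * T.e₂) * T.e₂ = T.lam • (x * T.e₂) := by
  refine T.M₂_induction (p := fun x ↦ T.EM1 (x * T.e₂) * T.e₂ = T.lam • (x * T.e₂))
    ?_ (by simp) ?_ ?_ x
  · intro w hw w' hw'
    have hM := T.hEM_mem w' hw'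
    have h : w * T.e₂ * w' * T.e₂ = w * T.e₂ * T.EM w' := by
      rw [mul_assoc w T.e₂ (T.EM w'), T.he₂M _ hM, ← T.he₂we₂ w' hw']
      simp only [mul_assoc]
    rw [h, T.hEM1_bimod _ hw _ (T.hMM₁ hM), T.hEM1e₂]
    simp only [mul_smul_comm, smul_mul_assoc, mul_one]
    rw [mul_assoc, mul_assoc, T.he₂M _ hM]
  · intro x y hx hy
    simp only [add_mul, map_add, hx, hy, smul_add]
  · intro c x hx
    simp only [smul_mul_assoc, map_smul, hx]
    rw [smul_comm]

theorem EM1_mem_A {c : R} (hc : ∀ n ∈ T.N, n * c = c * n) : T.EM1 c ∈ T.A := by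
  refine mem_A.2 ⟨T.hEM1_mem c, fun n hn ↦ ?_⟩
  have hn₁ := T.hMM₁ (T.hNM hn)
  rw [← T.EM1_left hn₁, ← T.EM1_right hn₁, hc n hn]

theorem e₁e₂_comm {n : R} (hn : n ∈ T.N) : n * (T.e₁ * T.e₂) = T.e₁ * T.e₂ * n := by
  rw [← mul_assoc, ← T.he₁N n hn, mul_assoc, ← T.he₂M n (T.hNM hn), mul_assoc]

theorem e₂e₁_comm {n : R} (hn : n ∈ T.N) : n * (T.e₂ * T.e₁) = T.e₂ * T.e₁ * n := by
  rw [← mul_assoc, ← T.he₂M n (T.hNM hn), mul_assoc, ← T.he₁N n hn, mul_assoc]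

theorem EM1_mul_e₁_mul_e₂_mem_A {b : R} (hb : b ∈ T.B) : T.EM1 (b * T.e₁ * T.e₂) ∈ T.A := by
  refine T.EM1_mem_A fun n hn ↦ ?_
  rw [mul_assoc b, ← mul_assoc n, mem_B.1 hb n (T.hNM hn), mul_assoc, T.e₁e₂_comm hn]
  simp only [mul_assoc]

theorem EM1_e₂_mul_e₁_mul_mem_A {b : R} (hb : b ∈ T.B) : T.EM1 (T.e₂ * T.e₁ * b) ∈ T.A := by
  refine T.EM1_mem_A fun n hn ↦ ?_
  rw [← mul_assoc n, T.e₂e₁_comm hn, mul_assoc, mem_B.1 hb n (T.hNM hn)]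
  simp only [mul_assoc]

theorem eq_zero_of_e₁_mul_eq_zero {b : R} (hb : b ∈ T.B) (h : T.e₁ * b = 0) : b = 0 := by
  have key : ∀ x ∈ T.M₁, x * b = 0 := fun x hx ↦ by
    refine T.M₁_induction (p := fun x ↦ x * b = 0) ?_ (by simp) ?_ ?_ hx
    · intro m hm m' hm'
      rw [mul_assoc, mem_B.1 hb m' hm', mul_assoc, ← mul_assoc T.e₁, h]; simp
    · intro x y hx hy; rw [add_mul, hx, hy, add_zero]
    · intro c x hx; rw [smul_mul_assoc, hx, smul_zero]
  simpa using key 1 (one_mem _)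

theorem eq_zero_of_mul_e₁_eq_zero {b : R} (hb : b ∈ T.B) (h : b * T.e₁ = 0) : b = 0 := by
  have key : ∀ x ∈ T.M₁, b * x = 0 := fun x hx ↦ by
    refine T.M₁_induction (p := fun x ↦ b * x = 0) ?_ (by simp) ?_ ?_ hx
    · intro m hm m' hm'
      rw [← mul_assoc, ← mul_assoc, ← mem_B.1 hb m hm, mul_assoc m, h]; simp
    · intro x y hx hy; rw [mul_add, hx, hy, add_zero]
    · intro c x hx; rw [mul_smul_comm, hx, smul_zero]
  simpa using key 1 (one_mem _)

theorem eq_zero_of_EM1_e₂_mul_e₁_mul {b : R} (hb : b ∈ T.B)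
    (h : T.EM1 (T.e₂ * T.e₁ * b) = 0) : b = 0 := by
  refine T.eq_zero_of_e₁_mul_eq_zero hb ?_
  have h₁ := T.e₂_mul_EM1 (T.e₁ * b)
  rw [← mul_assoc, h, mul_zero, eq_comm, smul_eq_zero_iff_right T.hlam] at h₁
  have h₂ : T.e₁ * T.e₂ * T.e₁ * b = 0 := by
    rw [mul_assoc T.e₁, mul_assoc T.e₁, h₁, mul_zero]
  rwa [T.hbraid₁, smul_mul_assoc, smul_eq_zero_iff_right T.hlam] at h₂

theorem eq_zero_of_EM1_mul_e₁_mul_e₂ {b : R} (hb : b ∈ T.B)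
    (h : T.EM1 (b * T.e₁ * T.e₂) = 0) : b = 0 := by
  refine T.eq_zero_of_mul_e₁_eq_zero hb ?_
  have h₁ := T.EM1_mul_e₂ (b * T.e₁)
  rw [h, zero_mul, eq_comm, smul_eq_zero_iff_right T.hlam] at h₁
  have h₂ : b * (T.e₁ * T.e₂ * T.e₁) = 0 := by
    rw [← mul_assoc, ← mul_assoc, h₁, zero_mul]
  rwa [T.hbraid₁, mul_smul_comm, smul_eq_zero_iff_right T.hlam] at h₂

/-- Averaging an element of `C` over the Casimir element of `E` lands in `B`. -/
theorem sum_mul_mul_mem_B {g : R} (hg : ∀ n ∈ T.N, n * g = g * n) :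
    ∑ i, T.xb i * g * T.yb i ∈ T.B := by
  refine mem_B.2 fun m hm ↦ ?_
  have hN : ∀ i j, T.E (T.yb j * (m * T.xb i)) ∈ T.N := fun i j ↦
    T.hE_mem _ (mul_mem (T.hyb j) (mul_mem hm (T.hxb i)))
  calc m * ∑ i, T.xb i * g * T.yb i
      = ∑ i, (m * T.xb i) * g * T.yb i := by simp only [Finset.mul_sum, mul_assoc]
    _ = ∑ i, (∑ j, T.xb j * T.E (T.yb j * (m * T.xb i))) * g * T.yb i := by
        simp only [T.hE_dual₂ _ (mul_mem hm (T.hxb _))]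
    _ = ∑ j, ∑ i, T.xb j * g * (T.E (T.yb j * (m * T.xb i)) * T.yb i) := by
        simp only [Finset.sum_mul]
        rw [Finset.sum_comm]
        refine Finset.sum_congr rfl fun j _ ↦ Finset.sum_congr rfl fun i _ ↦ ?_
        rw [mul_assoc (T.xb j), hg _ (hN i j)]; simp only [mul_assoc]
    _ = ∑ j, T.xb j * g * (∑ i, T.E ((T.yb j * m) * T.xb i) * T.yb i) := by
        simp only [Finset.mul_sum, mul_assoc]
    _ = (∑ i, T.xb i * g * T.yb i) * m := by
        simp only [T.hE_dual₁ _ (mul_mem (T.hyb _) hm), Finset.sum_mul]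
        simp only [mul_assoc]

theorem exists_EM1_e₂_mul_e₁_mul_eq {a : R} (ha : a ∈ T.A) :
    ∃ b ∈ T.B, T.EM1 (T.e₂ * T.e₁ * b) = a := by
  obtain ⟨ha₁, haN⟩ := mem_A.1 ha
  have hg : ∀ n ∈ T.N, n * (T.e₁ * T.e₂ * a) = T.e₁ * T.e₂ * a * n := fun n hn ↦ by
    rw [← mul_assoc n, T.e₁e₂_comm hn, mul_assoc, haN n hn]; simp only [mul_assoc]
  refine ⟨(T.lam * T.lam)⁻¹ • ∑ i, T.xb i * (T.e₁ * T.e₂ * a) * T.yb i,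
    T.B.smul_mem (T.sum_mul_mul_mem_B hg) _, ?_⟩
  have h : T.e₂ * T.e₁ * ∑ i, T.xb i * (T.e₁ * T.e₂ * a) * T.yb i = T.lam • (T.e₂ * a) := by
    have hi : ∀ i, T.e₂ * T.e₁ * (T.xb i * (T.e₁ * T.e₂ * a) * T.yb i)
        = T.lam • (T.e₂ * a * (T.E (T.xb i) * T.yb i)) := fun i ↦ by
      have hn := T.hE_mem _ (T.hxb i)
      calc _ = T.e₂ * (T.e₁ * T.xb i * T.e₁) * T.e₂ * a * T.yb i := by simp only [mul_assoc]
        _ = T.E (T.xb i) * (T.e₂ * T.e₁ * T.e₂) * a * T.yb i := by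
          rw [T.he₁me₁ _ (T.hxb i), ← mul_assoc T.e₂, T.he₂M _ (T.hNM hn)]
          simp only [mul_assoc]
        _ = T.lam • ((T.E (T.xb i) * T.e₂) * a * T.yb i) := by
          rw [T.hbraid₂]; simp only [mul_smul_comm, smul_mul_assoc]
        _ = _ := by
          rw [← T.he₂M _ (T.hNM hn), mul_assoc T.e₂, haN _ hn]; simp only [mul_assoc]
    have h1 := T.hE_dual₁ 1 (one_mem _)
    simp only [one_mul] at h1
    rw [Finset.mul_sum, Finset.sum_congr rfl fun i _ ↦ hi i, ← Finset.smul_sum,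
      ← Finset.mul_sum, h1, mul_one]
  rw [mul_smul_comm, h, map_smul, map_smul, T.EM1_right ha₁, T.hEM1e₂, smul_mul_assoc, one_mul,
    smul_smul, smul_smul, mul_assoc, inv_mul_cancel₀ (mul_ne_zero T.hlam T.hlam), one_smul]

theorem exists_EM1_mul_e₁_mul_e₂_eq {a : R} (ha : a ∈ T.A) :
    ∃ b ∈ T.B, T.EM1 (b * T.e₁ * T.e₂) = a := by
  obtain ⟨ha₁, haN⟩ := mem_A.1 ha
  have hg : ∀ n ∈ T.N, n * (a * (T.e₂ * T.e₁)) = a * (T.e₂ * T.e₁) * n := fun n hn ↦ by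
    rw [← mul_assoc n, haN n hn, mul_assoc, T.e₂e₁_comm hn]; simp only [mul_assoc]
  refine ⟨(T.lam * T.lam)⁻¹ • ∑ i, T.xb i * (a * (T.e₂ * T.e₁)) * T.yb i,
    T.B.smul_mem (T.sum_mul_mul_mem_B hg) _, ?_⟩
  have h : (∑ i, T.xb i * (a * (T.e₂ * T.e₁)) * T.yb i) * (T.e₁ * T.e₂)
      = T.lam • (a * T.e₂) := by
    have hi : ∀ i, T.xb i * (a * (T.e₂ * T.e₁)) * T.yb i * (T.e₁ * T.e₂)
        = T.lam • (T.xb i * T.E (T.yb i) * (a * T.e₂)) := fun i ↦ by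
      have hn := T.hE_mem _ (T.hyb i)
      calc _ = T.xb i * a * T.e₂ * (T.e₁ * T.yb i * T.e₁) * T.e₂ := by simp only [mul_assoc]
        _ = T.xb i * a * (T.e₂ * T.E (T.yb i)) * (T.e₁ * T.e₂) := by
          rw [T.he₁me₁ _ (T.hyb i)]; simp only [mul_assoc]
        _ = T.xb i * (a * T.E (T.yb i)) * (T.e₂ * T.e₁ * T.e₂) := by
          rw [T.he₂M _ (T.hNM hn)]; simp only [mul_assoc]
        _ = _ := by
          rw [T.hbraid₂, ← haN _ hn]; simp only [mul_smul_comm, mul_assoc]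
    have h1 := T.hE_dual₂ 1 (one_mem _)
    simp only [mul_one] at h1
    rw [Finset.sum_mul, Finset.sum_congr rfl fun i _ ↦ hi i, ← Finset.smul_sum,
      ← Finset.sum_mul, h1, one_mul]
  rw [mul_assoc, smul_mul_assoc, h, map_smul, map_smul, T.EM1_left ha₁, T.hEM1e₂, mul_smul_comm,
    mul_one, smul_smul, smul_smul, mul_assoc, inv_mul_cancel₀ (mul_ne_zero T.hlam T.hlam),
    one_smul]

theorem EM1_eq_smul_one {b : R} (hb : b ∈ T.B) : ∃ μ : k, T.EM1 b = μ • (1 : R) := by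
  refine T.hCM₁M _ (T.hEM1_mem b) fun m hm ↦ ?_
  rw [← T.EM1_left (T.hMM₁ hm), ← T.EM1_right (T.hMM₁ hm), mem_B.1 hb m hm]

theorem sum_zb_mul_e₂_mul_wb : ∑ i, T.zb i * T.e₂ * T.wb i = 1 := by
  have key : ∀ x : R, (∑ i, T.zb i * T.e₂ * T.wb i) * x = x := fun x ↦ by
    refine T.M₂_induction (p := fun x ↦ (∑ i, T.zb i * T.e₂ * T.wb i) * x = x)
      ?_ (by simp) ?_ ?_ x
    · intro w hw w' _
      have hi : ∀ i, T.zb i * T.e₂ * T.wb i * (w * T.e₂ * w')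
          = T.zb i * T.EM (T.wb i * w) * (T.e₂ * w') := fun i ↦ by
        calc _ = T.zb i * (T.e₂ * (T.wb i * w) * T.e₂) * w' := by simp only [mul_assoc]
          _ = _ := by rw [T.he₂we₂ _ (mul_mem (T.hwbM₁ i) hw)]; simp only [mul_assoc]
      rw [Finset.sum_mul, Finset.sum_congr rfl fun i _ ↦ hi i, ← Finset.sum_mul,
        T.hzw_dual₂ w hw, mul_assoc]
    · intro x y hx hy; rw [mul_add, hx, hy]
    · intro c x hx; rw [mul_smul_comm, hx]
  simpa using key 1

theorem exists_eq_sum_mul_e₂_mul (x : R) : ∃ p q : Fin T.r → R,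
    (∀ i, p i ∈ T.M₁) ∧ (∀ i, q i ∈ T.M₁) ∧ x = ∑ i, p i * T.e₂ * q i := by
  refine ⟨T.zb, fun i ↦ T.lam⁻¹ • T.EM1 (T.e₂ * (T.wb i * x)), T.hzbM₁,
    fun i ↦ T.M₁.smul_mem (T.hEM1_mem _) _, ?_⟩
  have hi : ∀ i, T.zb i * T.e₂ * (T.lam⁻¹ • T.EM1 (T.e₂ * (T.wb i * x)))
      = T.zb i * T.e₂ * T.wb i * x := fun i ↦ by
    rw [mul_smul_comm, mul_assoc, T.e₂_mul_EM1, mul_smul_comm, smul_smul,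
      inv_mul_cancel₀ T.hlam, one_smul]
    simp only [mul_assoc]
  rw [Finset.sum_congr rfl fun i _ ↦ hi i, ← Finset.sum_mul, T.sum_zb_mul_e₂_mul_wb, one_mul]

theorem e₂_ne_zero [Nontrivial R] : T.e₂ ≠ 0 := fun h ↦ by
  have := T.hEM1e₂
  rw [h, map_zero, eq_comm, smul_eq_zero_iff_right T.hlam] at this
  exact one_ne_zero this

/-- The characterizing relation of the antipode extends from `e₁` to all of `M₁`. -/
theorem EM1_mul_mul_e₂_eq {b b' : R} (hb : b ∈ T.B) (hb' : b' ∈ T.B)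
    (h : T.EM1 (b * T.e₁ * T.e₂) = T.EM1 (T.e₂ * T.e₁ * b')) {x : R} (hx : x ∈ T.M₁) :
    T.EM1 (b * x * T.e₂) = T.EM1 (T.e₂ * x * b') := by
  refine T.M₁_induction (p := fun x ↦ T.EM1 (b * x * T.e₂) = T.EM1 (T.e₂ * x * b'))
    ?_ (by simp) ?_ ?_ hx
  · intro m hm m' hm'
    have hl : b * (m * T.e₁ * m') * T.e₂ = m * (b * T.e₁ * T.e₂) * m' := by
      calc _ = b * m * T.e₁ * (m' * T.e₂) := by simp only [mul_assoc]
        _ = _ := by rw [← mem_B.1 hb m hm, ← T.he₂M m' hm']; simp only [mul_assoc]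
    have hr : T.e₂ * (m * T.e₁ * m') * b' = m * (T.e₂ * T.e₁ * b') * m' := by
      calc _ = T.e₂ * m * T.e₁ * (m' * b') := by simp only [mul_assoc]
        _ = _ := by rw [mem_B.1 hb' m' hm', T.he₂M m hm]; simp only [mul_assoc]
    rw [hl, hr, T.hEM1_bimod m (T.hMM₁ hm) m' (T.hMM₁ hm'),
      T.hEM1_bimod m (T.hMM₁ hm) m' (T.hMM₁ hm'), h]
  · intro x y hx hy; simp only [mul_add, add_mul, map_add, hx, hy]
  · intro c x hx; simp only [mul_smul_comm, smul_mul_assoc, map_smul, hx]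

theorem EM1_mul_eq_EM1_mul [Nontrivial R] {b c d b' : R} (hb : b ∈ T.B) (hd : d ∈ T.B)
    (hb' : b' ∈ T.B) (hbc : ∀ x ∈ T.M₁, T.EM1 (b * x * T.e₂) = T.EM1 (T.e₂ * x * c))
    (hcd : ∀ x ∈ T.M₁, T.EM1 (c * x * T.e₂) = T.EM1 (T.e₂ * x * d)) :
    T.EM1 (b * b') = T.EM1 (b' * d) := by
  obtain ⟨t, ht⟩ := T.EM1_eq_smul_one (mul_mem hb hb')
  obtain ⟨t', ht'⟩ := T.EM1_eq_smul_one (mul_mem hb' hd)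
  obtain ⟨p, q, hp, hq, hpq⟩ := T.exists_eq_sum_mul_e₂_mul b'
  have hl : T.e₂ * T.EM1 (b * b') = T.lam • (T.e₂ * ∑ i, p i * c * q i) := by
    simp only [hpq, Finset.mul_sum, map_sum, Finset.smul_sum]
    refine Finset.sum_congr rfl fun i _ ↦ ?_
    rw [← mul_assoc b, ← mul_assoc b, T.EM1_right (hq i), hbc _ (hp i), mul_assoc T.e₂,
      ← mul_assoc T.e₂ (T.EM1 _), T.e₂_mul_EM1, smul_mul_assoc, mul_assoc T.e₂]
  have hr : T.EM1 (b' * d) * T.e₂ = T.lam • ((∑ i, p i * c * q i) * T.e₂) := by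
    simp only [hpq, Finset.sum_mul, map_sum, Finset.smul_sum]
    refine Finset.sum_congr rfl fun i _ ↦ ?_
    rw [mul_assoc (p i), mul_assoc (p i), T.EM1_left (hp i), ← hcd _ (hq i), mul_assoc (p i),
      T.EM1_mul_e₂, mul_smul_comm]
    simp only [mul_assoc]
  have he : T.e₂ * T.e₂ = T.e₂ := by
    simpa [T.hEM_one] using T.he₂we₂ 1 (one_mem _)
  have h₁ : t • T.e₂ = T.lam • (T.e₂ * (∑ i, p i * c * q i) * T.e₂) := by
    rw [← smul_mul_assoc, ← hl, ht]; simp [he]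
  have h₂ : t' • T.e₂ = T.lam • (T.e₂ * (∑ i, p i * c * q i) * T.e₂) := by
    rw [mul_assoc, ← mul_smul_comm, ← hr, ht']; simp [he]
  rw [ht, ht', smul_left_injective k T.e₂_ne_zero (h₁.trans h₂.symm)]

end JonesTower

/-- **The antipode of `B`.** (a) There is a unique map `S : B → B` with
`E_{M₁}(b e₁ e₂) = E_{M₁}(e₂ e₁ S(b))` for all `b ∈ B`, and any such map is
bijective; (b) `S²` is the inverse of the Nakayama automorphism of `E_{M₁}|_B`,
i.e. `E_{M₁}(b b') = E_{M₁}(b' S²(b))`; (c) `E_{M₁}(b x e₂) = E_{M₁}(e₂ x S(b))`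
for all `x ∈ M₁`. -/
theorem antipode_of_B (T : JonesTower k R) [Nontrivial R] :
    (∃! S : ↥T.B → ↥T.B, ∀ b : ↥T.B,
      T.EM1 ((b : R) * T.e₁ * T.e₂) = T.EM1 (T.e₂ * T.e₁ * (S b : R))) ∧
    (∀ S : ↥T.B → ↥T.B,
      (∀ b : ↥T.B, T.EM1 ((b : R) * T.e₁ * T.e₂) = T.EM1 (T.e₂ * T.e₁ * (S b : R))) →
      Function.Bijective S ∧
      (∀ b b' : ↥T.B, T.EM1 ((b : R) * (b' : R)) = T.EM1 ((b' : R) * (S (S b) : R))) ∧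
      (∀ b : ↥T.B, ∀ x ∈ T.M₁,
        T.EM1 ((b : R) * x * T.e₂) = T.EM1 (T.e₂ * x * (S b : R)))) := by
  have inj : ∀ b c : ↥T.B, T.EM1 (T.e₂ * T.e₁ * (b : R)) = T.EM1 (T.e₂ * T.e₁ * (c : R)) →
      b = c := fun b c h ↦ by
    refine Subtype.ext (sub_eq_zero.1 (T.eq_zero_of_EM1_e₂_mul_e₁_mul (sub_mem b.2 c.2) ?_))
    rw [mul_sub, map_sub, h, sub_self]
  refine ⟨?_, fun S hS ↦ ?_⟩
  · choose S hSB hS using fun b : ↥T.B ↦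
      T.exists_EM1_e₂_mul_e₁_mul_eq (T.EM1_mul_e₁_mul_e₂_mem_A b.2)
    exact ⟨fun b ↦ ⟨S b, hSB b⟩, fun b ↦ (hS b).symm,
      fun S' hS' ↦ funext fun b ↦ inj _ _ ((hS' b).symm.trans (hS b).symm)⟩
  · have hc : ∀ b : ↥T.B, ∀ x ∈ T.M₁,
        T.EM1 ((b : R) * x * T.e₂) = T.EM1 (T.e₂ * x * (S b : R)) :=
      fun b _ hx ↦ T.EM1_mul_mul_e₂_eq b.2 (S b).2 (hS b) hx
    refine ⟨⟨fun b c h ↦ ?_, fun c ↦ ?_⟩, fun b b' ↦ ?_, hc⟩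
    · refine Subtype.ext (sub_eq_zero.1 (T.eq_zero_of_EM1_mul_e₁_mul_e₂ (sub_mem b.2 c.2) ?_))
      rw [sub_mul, sub_mul, map_sub, hS, hS, h, sub_self]
    · obtain ⟨b, hb, h⟩ := T.exists_EM1_mul_e₁_mul_e₂_eq (T.EM1_e₂_mul_e₁_mul_mem_A c.2)
      exact ⟨⟨b, hb⟩, inj _ _ ((hS ⟨b, hb⟩).symm.trans h)⟩
    · exact T.EM1_mul_eq_EM1_mul b.2 (S (S b)).2 b'.2 (hc b) (hc (S b))
end
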